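/- Let μ be a partition of n+1 with exactly two corner cells, and let α⁽¹⁾ and α⁽²⁾ be the two partitions of n obtained by removing one of the corner cells of μ. If dim_ℚ M_{α⁽¹⁾} = dim_ℚ M_{α⁽²⁾} = n! and dim_ℚ ( M_{α⁽¹⁾} ∩ M_{α⁽²⁾} ) = n!/2, then dim_ℚ { P ∈ M_{α⁽ⁱ⁾} : ⟨P,Q⟩ = 0 for all Q ∈ M_{α⁽¹⁾} ∩ M_{α⁽²⁾} } = n!/2 for i = 1,2, and dim_ℚ M_μ = (n+1)!. -/

import Mathlib

open MvPolynomial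

/-- The Garsia–Haiman determinant `Δ_μ`. -/
noncomputable def Delta (n : ℕ) (cells : Finset (ℕ × ℕ))
    (e : Fin n ≃ {c // c ∈ cells}) : MvPolynomial (Fin n ⊕ Fin n) ℚ :=
  Matrix.det (Matrix.of fun r c : Fin n =>
    X (Sum.inl r) ^ ((e c).val.1) * X (Sum.inr r) ^ ((e c).val.2))

/-- The linear span of a polynomial `Δ` together with all of its partial
derivatives of all orders. -/
noncomputable def derivSpan (n : ℕ) (Δ : MvPolynomial (Fin n ⊕ Fin n) ℚ) :
    Submodule ℚ (MvPolynomial (Fin n ⊕ Fin n) ℚ) :=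
  Submodule.span ℚ
    {P | ∃ L : List (Fin n ⊕ Fin n), P = L.foldr (fun v Q => pderiv v Q) Δ}

/-- The Garsia–Haiman module `M_μ`. -/
noncomputable def GHmodule (n : ℕ) (cells : Finset (ℕ × ℕ))
    (e : Fin n ≃ {c // c ∈ cells}) : Submodule ℚ (MvPolynomial (Fin n ⊕ Fin n) ℚ) :=
  derivSpan n (Delta n cells e)

/-- A finite subset of `ℕ × ℕ` is the (0-indexed, French-convention) diagram of
a partition iff it is a lower set. -/
def IsLowerDiagram (cells : Finset (ℕ × ℕ)) : Prop :=
  ∀ c ∈ cells, ∀ c' : ℕ × ℕ, c'.1 ≤ c.1 → c'.2 ≤ c.2 → c' ∈ cells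

/-- A corner cell of a diagram: a cell whose removal leaves a partition diagram. -/
def IsCornerCell (cells : Finset (ℕ × ℕ)) (c : ℕ × ℕ) : Prop :=
  c ∈ cells ∧ IsLowerDiagram (cells.erase c)

/-- The differential operator `∂^d = ∏_v ∂_v^{d v}` (the factors commute, so the
order of the product is immaterial). -/
noncomputable def derivMonomial (n : ℕ) (d : (Fin n ⊕ Fin n) →₀ ℕ) :
    Module.End ℚ (MvPolynomial (Fin n ⊕ Fin n) ℚ) :=
  (d.support.toList.map fun v =>
    ((pderiv v).toLinearMap : Module.End ℚ (MvPolynomial (Fin n ⊕ Fin n) ℚ)) ^ d v).prod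

/-- `P(∂) Q`: the result of applying to `Q` the differential operator obtained
by substituting `∂_{x_i}` for `x_i` and `∂_{y_i}` for `y_i` in `P`. -/
noncomputable def applyDiff (n : ℕ)
    (P Q : MvPolynomial (Fin n ⊕ Fin n) ℚ) : MvPolynomial (Fin n ⊕ Fin n) ℚ :=
  ∑ d ∈ P.support, coeff d P • derivMonomial n d Q

/-- The apolar scalar product `⟨P,Q⟩ = (P(∂) Q)(0)`. -/
noncomputable def apolar (n : ℕ) (P Q : MvPolynomial (Fin n ⊕ Fin n) ℚ) : ℚ :=
  constantCoeff (applyDiff n P Q)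



section General
variable {M : Type} [AddCommMonoid M]

def shiftF (g : M → ℚ) (d : M) : M → ℚ := fun e => g (d + e)

def SS (g : M → ℚ) : Submodule ℚ (M → ℚ) := Submodule.span ℚ (Set.range (shiftF g))

theorem rank_degen (wt : M →+ ℤ) (D : ℤ) (g h : M → ℚ)
    (hlow : ∀ d, wt d < D → h d = 0) (heq : ∀ d, wt d = D → g d = h d)
    (hg : ∀ d, wt d ≠ D → g d = 0) :
    Module.rank ℚ (SS g) ≤ Module.rank ℚ (SS h) := by
  obtain ⟨b, hbs, hspan, hli⟩ := exists_linearIndependent ℚ (Set.range (shiftF g))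
  choose d hd using fun x : b => hbs x.2
  have key : LinearIndependent ℚ (fun x : b => shiftF h (d x)) := by
    rw [linearIndependent_iff'] at hli ⊢
    intro s c hs
    by_contra hcon
    push Not at hcon
    obtain ⟨i, his, hi⟩ := hcon
    obtain ⟨j, hj, hmax⟩ := Finset.exists_max_image (s.filter (fun i => c i ≠ 0))
      (fun i => wt (d i)) ⟨i, by simp [his, hi]⟩
    simp only [Finset.mem_filter] at hj hmax
    refine hj.2 (hli ((s.filter (fun i => c i ≠ 0)).filter (fun i => wt (d i) = wt (d j)))
      c ?_ j (by simp [hj]))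
    funext e
    simp only [Finset.sum_apply, Pi.smul_apply, smul_eq_mul, Pi.zero_apply]
    by_cases he : wt (d j) + wt e = D
    · have h0 := congrFun hs e
      simp only [Finset.sum_apply, Pi.smul_apply, smul_eq_mul, Pi.zero_apply, shiftF] at h0
      refine Eq.trans ?_ h0
      rw [Finset.sum_filter, Finset.sum_filter]
      refine Finset.sum_congr rfl fun k hk => ?_
      by_cases hc : c k = 0
      · simp [hc]
      · rw [if_pos hc]
        split_ifs with hw
        · rw [← hd k]
          simp only [shiftF]
          rw [heq _ (by rw [map_add, hw, he])]
        · rw [hlow _, mul_zero]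
          have := hmax k ⟨hk, hc⟩
          rw [map_add]
          omega
    · refine Finset.sum_eq_zero fun k hk => ?_
      simp only [Finset.mem_filter] at hk
      rw [← hd k]
      simp only [shiftF]
      rw [hg _ (by rw [map_add, hk.2]; exact he), mul_zero]
  have key2 : LinearIndependent ℚ (fun x : b => (⟨shiftF h (d x),
      Submodule.subset_span ⟨_, rfl⟩⟩ : SS h)) :=
    LinearIndependent.of_comp (SS h).subtype key
  have h1 := key2.cardinal_le_rank
  have h2 : Module.rank ℚ (SS g) = Cardinal.mk b := by
    unfold SS
    rw [← hspan]
    exact rank_span_set hli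
  rw [h2]
  exact h1

theorem finrank_degen (wt : M →+ ℤ) (D : ℤ) (g h : M → ℚ)
    (hlow : ∀ d, wt d < D → h d = 0) (heq : ∀ d, wt d = D → g d = h d)
    (hg : ∀ d, wt d ≠ D → g d = 0) [FiniteDimensional ℚ (SS h)] :
    FiniteDimensional ℚ (SS g) ∧ Module.finrank ℚ (SS g) ≤ Module.finrank ℚ (SS h) := by
  have hr := rank_degen wt D g h hlow heq hg
  have hlt : Module.rank ℚ (SS h) < Cardinal.aleph0 := Module.rank_lt_aleph0 ℚ _
  exact ⟨Module.rank_lt_aleph0_iff.mp (hr.trans_lt hlt), Cardinal.toNat_le_toNat hr hlt⟩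

/-- span of the pairs of shifts -/
noncomputable def ZZ (g₁ g₂ : M → ℚ) : Submodule ℚ ((M → ℚ) × (M → ℚ)) :=
  LinearMap.range (Finsupp.linearCombination ℚ (fun d => (shiftF g₁ d, shiftF g₂ d)))

theorem SS_add_le (g₁ g₂ : M → ℚ) : SS (g₁ + g₂) ≤ SS g₁ ⊔ SS g₂ := by
  refine Submodule.span_le.mpr ?_
  rintro _ ⟨d, rfl⟩
  exact Submodule.add_mem_sup (Submodule.subset_span ⟨d, rfl⟩) (Submodule.subset_span ⟨d, rfl⟩)

theorem ZZ_le (g₁ g₂ : M → ℚ) : ZZ g₁ g₂ ≤ (SS g₁).prod (SS g₂) := by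
  unfold ZZ
  rw [Finsupp.range_linearCombination]
  refine Submodule.span_le.mpr ?_
  rintro _ ⟨d, rfl⟩
  exact ⟨Submodule.subset_span ⟨d, rfl⟩, Submodule.subset_span ⟨d, rfl⟩⟩

theorem finite_ZZ (g₁ g₂ : M → ℚ) [FiniteDimensional ℚ (SS g₁)] [FiniteDimensional ℚ (SS g₂)] :
    FiniteDimensional ℚ (ZZ g₁ g₂) := by
  have : FiniteDimensional ℚ ((SS g₁).prod (SS g₂) : Submodule ℚ _) :=
    Module.Finite.iff_fg.mpr
      ((Module.Finite.iff_fg.mp inferInstance).prod (Module.Finite.iff_fg.mp inferInstance))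
  exact Submodule.finiteDimensional_of_le (ZZ_le g₁ g₂)

theorem finrank_le_ZZ (g₁ g₂ : M → ℚ)
    [FiniteDimensional ℚ (SS g₁)] [FiniteDimensional ℚ (SS g₂)] :
    Module.finrank ℚ (SS g₁ ⊔ SS g₂ : Submodule ℚ _) ≤ Module.finrank ℚ (ZZ g₁ g₂) := by
  set N := SS g₁ ⊔ SS g₂ with hN
  have := finite_ZZ g₁ g₂
  let ev : M → Module.Dual ℚ N := fun d => (LinearMap.proj d).comp N.subtype
  let Ψ : (M →₀ ℚ) →ₗ[ℚ] Module.Dual ℚ N := Finsupp.linearCombination ℚ ev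
  let Φ := Finsupp.linearCombination ℚ (fun d => (shiftF g₁ d, shiftF g₂ d))
  have hker : LinearMap.ker Φ ≤ LinearMap.ker Ψ := by
    intro f hf
    rw [LinearMap.mem_ker] at hf ⊢
    have h1 : ∀ u ∈ N, (f.sum fun d c => c * u d) = 0 := by
      have hle : N ≤ LinearMap.ker (Finsupp.linearCombination ℚ
          (fun d => (LinearMap.proj d : (M → ℚ) →ₗ[ℚ] ℚ)) f) := by
        rw [hN]
        refine sup_le (Submodule.span_le.mpr ?_) (Submodule.span_le.mpr ?_)
        · rintro _ ⟨e, rfl⟩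
          have := congrFun (congrArg Prod.fst hf) e
          simp only [Φ, Finsupp.linearCombination_apply, Finsupp.sum, Prod.fst_sum,
            Finset.sum_apply, Prod.smul_fst, Pi.smul_apply, smul_eq_mul, shiftF] at this
          simpa [Finsupp.linearCombination_apply, Finsupp.sum, shiftF, add_comm e] using this
        · rintro _ ⟨e, rfl⟩
          have := congrFun (congrArg Prod.snd hf) e
          simp only [Φ, Finsupp.linearCombination_apply, Finsupp.sum, Prod.snd_sum,
            Finset.sum_apply, Prod.smul_snd, Pi.smul_apply, smul_eq_mul, shiftF] at this
          simpa [Finsupp.linearCombination_apply, Finsupp.sum, shiftF, add_comm e] using this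
      intro u hu
      simpa [Finsupp.linearCombination_apply, Finsupp.sum] using hle hu
    ext ⟨u, hu⟩
    simpa [Ψ, ev, Finsupp.linearCombination_apply, Finsupp.sum] using h1 u hu
  have : FiniteDimensional ℚ (LinearMap.range Φ) := finite_ZZ g₁ g₂
  have hco : (LinearMap.range Ψ).dualCoannihilator = ⊥ := by
    rw [eq_bot_iff]
    intro u hu
    rw [Submodule.mem_dualCoannihilator] at hu
    rw [Submodule.mem_bot]
    ext d
    have := hu (Ψ (Finsupp.single d 1)) ⟨_, rfl⟩
    simpa [Ψ, ev] using this
  have h2 := Subspace.finrank_add_finrank_dualCoannihilator_eq (LinearMap.range Ψ)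
  rw [hco, finrank_bot, add_zero] at h2
  rw [← h2]
  let Θ : LinearMap.range Φ →ₗ[ℚ] Module.Dual ℚ N :=
    ((LinearMap.ker Φ).liftQ Ψ hker).comp Φ.quotKerEquivRange.symm.toLinearMap
  have h3 : LinearMap.range Ψ ≤ LinearMap.range Θ := by
    rintro _ ⟨f, rfl⟩
    refine ⟨⟨Φ f, f, rfl⟩, ?_⟩
    simp only [Θ, LinearMap.comp_apply, LinearEquiv.coe_coe]
    have : Φ.quotKerEquivRange.symm ⟨Φ f, f, rfl⟩ = (LinearMap.ker Φ).mkQ f := by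
      rw [LinearEquiv.symm_apply_eq]; rfl
    rw [this]; simp
  exact (Submodule.finrank_mono h3).trans (LinearMap.finrank_range_le Θ)

theorem finrank_SS_add (g₁ g₂ : M → ℚ)
    [FiniteDimensional ℚ (SS g₁)] [FiniteDimensional ℚ (SS g₂)] :
    Module.finrank ℚ (SS g₁) + Module.finrank ℚ (SS g₂) ≤
      Module.finrank ℚ (SS (g₁ + g₂)) +
        2 * Module.finrank ℚ (SS g₁ ⊓ SS g₂ : Submodule ℚ _) := by
  have hz := finrank_le_ZZ g₁ g₂
  have hs := Submodule.finrank_sup_add_finrank_inf_eq (SS g₁) (SS g₂)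
  have := finite_ZZ g₁ g₂
  have hfs : FiniteDimensional ℚ (SS (g₁ + g₂)) :=
    Submodule.finiteDimensional_of_le (SS_add_le g₁ g₂)
  let A : ZZ g₁ g₂ →ₗ[ℚ] (M → ℚ) :=
    (LinearMap.fst ℚ _ _ + LinearMap.snd ℚ _ _).comp (ZZ g₁ g₂).subtype
  have hr := LinearMap.finrank_range_add_finrank_ker A
  have h1 : LinearMap.range A ≤ SS (g₁ + g₂) := by
    rintro _ ⟨⟨z, hz⟩, rfl⟩
    have : ZZ g₁ g₂ ≤ (SS (g₁ + g₂)).comap (LinearMap.fst ℚ _ _ + LinearMap.snd ℚ _ _) := by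
      unfold ZZ
      rw [Finsupp.range_linearCombination]
      refine Submodule.span_le.mpr ?_
      rintro _ ⟨d, rfl⟩
      exact Submodule.subset_span ⟨d, rfl⟩
    exact this hz
  have h2 : Module.finrank ℚ (LinearMap.ker A) ≤
      Module.finrank ℚ (SS g₁ ⊓ SS g₂ : Submodule ℚ _) := by
    let T : LinearMap.ker A →ₗ[ℚ] (M → ℚ) :=
      (LinearMap.fst ℚ _ _).comp ((ZZ g₁ g₂).subtype.comp (LinearMap.ker A).subtype)
    have hA : ∀ x : LinearMap.ker A, x.1.1.1 + x.1.1.2 = 0 := fun x => x.2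
    have hT : Function.Injective T := by
      rw [injective_iff_map_eq_zero]
      intro x hx
      have h1 : x.1.1.1 = 0 := hx
      have h2 := hA x
      rw [h1, zero_add] at h2
      exact Subtype.ext (Subtype.ext (Prod.ext h1 h2))
    rw [← LinearMap.finrank_range_of_inj hT]
    refine Submodule.finrank_mono ?_
    rintro _ ⟨x, rfl⟩
    have hm := ZZ_le g₁ g₂ x.1.2
    refine ⟨hm.1, ?_⟩
    have : x.1.1.1 = - x.1.1.2 := eq_neg_of_add_eq_zero_left (hA x)
    change x.1.1.1 ∈ SS g₂
    rw [this]
    exact neg_mem hm.2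
  have h3 := Submodule.finrank_mono h1
  omega

end General

section Upper

def degP (z : ℕ × ℕ) : ℤ := (z.1 : ℤ) + z.2

theorem degP_mono {a b : ℕ × ℕ} (h : a ≤ b) : degP a ≤ degP b := by
  have := h.1; have := h.2; unfold degP; omega

theorem degP_eq {a b : ℕ × ℕ} (h : a ≤ b) (h' : degP a = degP b) : a = b := by
  have := h.1; have := h.2; unfold degP at h'
  ext <;> omega

/-- indicator determinant -/
def gd {n : ℕ} (e d : Fin n → ℕ × ℕ) : ℚ :=
  Matrix.det (Matrix.of fun r c : Fin n => if e c = d r then (1 : ℚ) else 0)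

theorem tri_det {n : ℕ} (T : Matrix (Fin n) (Fin n) ℚ) (e d : Fin n → ℕ × ℕ)
    (hT : ∀ r c, T r c ≠ 0 → e c ≤ d r) (hdeg : ∑ r, degP (d r) ≤ ∑ r, degP (e r)) :
    T.det = Matrix.det (Matrix.of fun r c : Fin n => if e c = d r then T r c else 0) := by
  rw [Matrix.det_apply, Matrix.det_apply]
  refine Finset.sum_congr rfl fun σ _ => ?_
  congr 1
  by_cases h : ∀ i, e i ≤ d (σ i)
  · have hsum : ∑ i, degP (d (σ i)) = ∑ i, degP (d i) := Equiv.sum_comp σ (fun i => degP (d i))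
    have h1 : ∑ i, degP (e i) = ∑ i, degP (d (σ i)) :=
      le_antisymm (Finset.sum_le_sum fun i _ => degP_mono (h i)) (by rw [hsum]; exact hdeg)
    have h2 := (Finset.sum_eq_sum_iff_of_le (fun i _ => degP_mono (h i))).mp h1
    refine Finset.prod_congr rfl fun i hi => ?_
    simp [degP_eq (h i) (h2 i hi)]
  · push Not at h
    obtain ⟨i, hi⟩ := h
    have h1 : T (σ i) i = 0 := by
      by_contra h0
      exact hi (hT _ _ h0)
    have h2 : ∏ j, T (σ j) j = 0 := Finset.prod_eq_zero (Finset.mem_univ i) h1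
    refine h2.trans ?_
    symm
    refine Finset.prod_eq_zero (Finset.mem_univ i) ?_
    change (if e i = d (σ i) then T (σ i) i else 0) = 0
    rw [h1, ite_self]

theorem gd_eq_zero {n : ℕ} (e d : Fin n → ℕ × ℕ) (h : ¬ ∃ σ : Equiv.Perm (Fin n), ∀ i, e i = d (σ i)) :
    gd e d = 0 := by
  unfold gd
  rw [Matrix.det_apply]
  refine Finset.sum_eq_zero fun σ _ => ?_
  push Not at h
  obtain ⟨i, hi⟩ := h σ
  rw [Finset.prod_eq_zero (Finset.mem_univ i) (by simp [hi]), smul_zero]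

theorem gd_eq_zero_of_sum {n : ℕ} {A : Type} [AddCommMonoid A] (f : ℕ × ℕ → A) (e d : Fin n → ℕ × ℕ)
    (h : ∑ r, f (d r) ≠ ∑ r, f (e r)) :
    gd e d = 0 := by
  refine gd_eq_zero e d ?_
  rintro ⟨σ, hσ⟩
  refine h ?_
  simp only [hσ]
  exact (Equiv.sum_comp σ (fun i => f (d i))).symm

theorem stir (m : ℕ) : ∃ s : ℕ → ℚ, s m = 1 ∧ (∀ k, m < k → s k = 0) ∧
    ∀ p : ℕ, (p : ℚ) ^ m = ∑ k ∈ Finset.range (m + 1), s k * (p.descFactorial k : ℚ) := by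
  induction m with
  | zero => exact ⟨fun k => if k = 0 then 1 else 0, by simp, by intro k hk; simp; omega, by simp⟩
  | succ m ih =>
    obtain ⟨s, h1, h2, h3⟩ := ih
    refine ⟨fun k => (if k = 0 then 0 else s (k - 1)) + k * s k, by simp [h1, h2 (m+1)], ?_, ?_⟩
    · intro k hk
      dsimp only
      rw [h2 k (by omega), h2 (k-1) (by omega)]; simp
    · intro p
      have hd : ∀ k, (p.descFactorial (k + 1) : ℚ) = ((p : ℚ) - k) * p.descFactorial k := by
        intro k
        rw [Nat.descFactorial_succ]
        push_cast
        rcases le_or_gt k p with h | h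
        · rw [Nat.cast_sub h]
        · rw [Nat.descFactorial_eq_zero_iff_lt.mpr h]; simp
      simp only [add_mul, Finset.sum_add_distrib]
      rw [Finset.sum_range_succ' _ (m+1), Finset.sum_range_succ _ (m+1), h2 (m+1) (by omega),
        pow_succ, h3 p, Finset.sum_mul]
      simp only [Nat.add_eq_zero_iff, one_ne_zero, and_false, if_false, if_true, Nat.add_sub_cancel,
        zero_mul, mul_zero, add_zero]
      rw [← Finset.sum_add_distrib]
      refine Finset.sum_congr rfl fun k _ => ?_
      rw [hd k]; ring

/-- determinant of the evaluated monomials -/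
def hd {n : ℕ} (e d : Fin n → ℕ × ℕ) : ℚ :=
  Matrix.det (Matrix.of fun r c : Fin n => ((e c).1 : ℚ) ^ (d r).1 * ((e c).2 : ℚ) ^ (d r).2)

theorem hd_SS {n : ℕ} (e : Fin n → ℕ × ℕ) (C : ℚ) :
    FiniteDimensional ℚ (SS (C • hd e)) ∧ Module.finrank ℚ (SS (C • hd e)) ≤ n.factorial := by
  let χ : Equiv.Perm (Fin n) → (Fin n → ℕ × ℕ) → ℚ := fun σ d =>
    ∏ i, (((e i).1 : ℚ) ^ (d (σ i)).1 * ((e i).2 : ℚ) ^ (d (σ i)).2)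
  have hle : SS (C • hd e) ≤ Submodule.span ℚ (Set.range χ) := by
    refine Submodule.span_le.mpr ?_
    rintro _ ⟨d, rfl⟩
    have : shiftF (C • hd e) d =
        ∑ σ : Equiv.Perm (Fin n), (C * ((Equiv.Perm.sign σ : ℤ) : ℚ) * χ σ d) • χ σ := by
      funext x
      simp only [shiftF, hd, Pi.smul_apply, Matrix.det_apply', Finset.sum_apply, smul_eq_mul,
        Finset.mul_sum]
      refine Finset.sum_congr rfl fun σ _ => ?_
      rw [mul_assoc, mul_assoc, ← Finset.prod_mul_distrib]
      congr 2
      refine Finset.prod_congr rfl fun i _ => ?_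
      simp [pow_add]; ring
    rw [this]
    exact Submodule.sum_mem _ fun σ _ => Submodule.smul_mem _ _ (Submodule.subset_span ⟨σ, rfl⟩)
  have hfin : FiniteDimensional ℚ (Submodule.span ℚ (Set.range χ)) :=
    FiniteDimensional.span_of_finite ℚ (Set.finite_range χ)
  refine ⟨Submodule.finiteDimensional_of_le hle, (Submodule.finrank_mono hle).trans ?_⟩
  have := finrank_range_le_card (R := ℚ) χ
  rw [Fintype.card_perm, Fintype.card_fin] at this
  exact this

theorem hd_eq {n : ℕ} (e : Fin n → ℕ × ℕ) (hinj : Function.Injective e)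
    (hlow : IsLowerSet (Set.range e)) : ∃ C : ℚ, C ≠ 0 ∧ ∀ d : Fin n → ℕ × ℕ,
      ∑ r, degP (d r) ≤ ∑ r, degP (e r) → hd e d = C * gd e d := by
  choose s hs1 hs2 hs3 using stir
  let N : Matrix (Fin n) (Fin n) ℚ := Matrix.of fun c' c =>
    ((e c).1.descFactorial (e c').1 : ℚ) * ((e c).2.descFactorial (e c').2 : ℚ)
  refine ⟨N.det, ?_, ?_⟩
  · rw [← Matrix.det_transpose, tri_det N.transpose e e ?_ le_rfl]
    · have : (Matrix.of fun r c : Fin n => if e c = e r then N.transpose r c else 0) =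
          Matrix.diagonal fun r => N r r := by
        ext r c
        by_cases h : r = c
        · subst h; simp
        · have : e c ≠ e r := fun h' => h (hinj h'.symm)
          simp [h, this]
      rw [this, Matrix.det_diagonal, Finset.prod_ne_zero_iff]
      intro i _
      simp [N, Nat.descFactorial_self, Nat.factorial_ne_zero]
    · intro r c h
      simp only [N, Matrix.transpose_apply, Matrix.of_apply, ne_eq, mul_eq_zero, not_or,
        Nat.cast_eq_zero, Nat.descFactorial_eq_zero_iff_lt, not_lt] at h
      exact h
  · intro d hdeg
    let T : Matrix (Fin n) (Fin n) ℚ := Matrix.of fun r c => s (d r).1 (e c).1 * s (d r).2 (e c).2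
    have hTN : (Matrix.of fun r c : Fin n =>
        ((e c).1 : ℚ) ^ (d r).1 * ((e c).2 : ℚ) ^ (d r).2) = T * N := by
      ext r c
      rw [Matrix.mul_apply]
      simp only [Matrix.of_apply, T, N]
      rw [hs3, hs3, Finset.sum_mul_sum, ← Finset.sum_product']
      let F : ℕ × ℕ → ℚ := fun z => s (d r).1 z.1 * ((e c).1.descFactorial z.1 : ℚ) *
        (s (d r).2 z.2 * ((e c).2.descFactorial z.2 : ℚ))
      have h1 : ∑ j, s (d r).1 (e j).1 * s (d r).2 (e j).2 * (((e c).1.descFactorial (e j).1 : ℚ) *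
          ((e c).2.descFactorial (e j).2 : ℚ)) = ∑ z ∈ Finset.univ.image e, F z := by
        rw [Finset.sum_image (fun a _ b _ h => hinj h)]
        refine Finset.sum_congr rfl fun j _ => ?_
        simp only [F]; ring
      rw [h1]
      change ∑ z ∈ _, F z = _
      trans ∑ z ∈ (Finset.univ.image e ∪
        Finset.range ((d r).1 + 1) ×ˢ Finset.range ((d r).2 + 1)), F z
      · refine Finset.sum_subset Finset.subset_union_right ?_
        intro z _ hz
        simp only [Finset.mem_product, Finset.mem_range, not_and_or, not_lt] at hz
        rcases hz with hz | hz
        · simp [F, hs2 _ z.1 (by omega : (d r).1 < z.1)]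
        · simp [F, hs2 _ z.2 (by omega : (d r).2 < z.2)]
      · symm
        refine Finset.sum_subset Finset.subset_union_left ?_
        intro z _ hz
        have hz' : ¬ z ≤ e c := fun hle => by
          obtain ⟨j, hj⟩ := hlow hle ⟨c, rfl⟩
          exact hz (by simp [← hj])
        rw [Prod.le_def, not_and_or, not_le, not_le] at hz'
        rcases hz' with hz | hz
        · simp [F, Nat.descFactorial_eq_zero_iff_lt.mpr hz]
        · simp [F, Nat.descFactorial_eq_zero_iff_lt.mpr hz]
    unfold hd
    rw [hTN, Matrix.det_mul, mul_comm, tri_det T e d ?_ hdeg]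
    · unfold gd
      congr 2
      ext r c
      simp only [Matrix.of_apply, T]
      split_ifs with h
      · rw [h, hs1, hs1, mul_one]
      · rfl
    · intro r c h
      by_contra hle
      rw [Prod.le_def, not_and_or, not_le, not_le] at hle
      apply h
      rcases hle with hz | hz
      · simp [T, hs2 _ _ hz]
      · simp [T, hs2 _ _ hz]

/-- additive weight on exponent vectors -/
def wtSum {n : ℕ} : (Fin n → ℕ × ℕ) →+ ℤ where
  toFun d := ∑ r, degP (d r)
  map_zero' := by simp [degP]
  map_add' a b := by
    rw [← Finset.sum_add_distrib]
    refine Finset.sum_congr rfl fun i _ => ?_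
    simp [degP]; ring

theorem upper {n : ℕ} (e : Fin n → ℕ × ℕ) (hinj : Function.Injective e)
    (hlow : IsLowerSet (Set.range e)) :
    FiniteDimensional ℚ (SS (gd e)) ∧ Module.finrank ℚ (SS (gd e)) ≤ n.factorial := by
  obtain ⟨C, hC, h⟩ := hd_eq e hinj hlow
  obtain ⟨hf, hle⟩ := hd_SS e C⁻¹
  have hh : ∀ d, wtSum d ≤ ∑ r, degP (e r) → (C⁻¹ • hd e) d = gd e d := by
    intro d hd
    simp only [Pi.smul_apply, smul_eq_mul]
    rw [h d hd, inv_mul_cancel_left₀ hC]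
  have := finrank_degen wtSum (∑ r, degP (e r)) (gd e) (C⁻¹ • hd e)
    (fun d hd => by rw [hh d hd.le]; exact gd_eq_zero_of_sum degP e d hd.ne)
    (fun d hd => (hh d hd.le).symm)
    (fun d hd => gd_eq_zero_of_sum degP e d hd)
  exact ⟨this.1, this.2.trans hle⟩

end Upper

section Lower

theorem SS_smul {M : Type} [AddCommMonoid M] (a : ℚ) (ha : a ≠ 0) (g : M → ℚ) :
    SS (a • g) = SS g := by
  have h : ∀ (a : ℚ) (g : M → ℚ), SS (a • g) ≤ SS g := by
    intro a g
    refine Submodule.span_le.mpr ?_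
    rintro _ ⟨d, rfl⟩
    exact Submodule.smul_mem _ a (Submodule.subset_span ⟨d, rfl⟩)
  refine le_antisymm (h a g) ?_
  have := h a⁻¹ (a • g)
  rwa [smul_smul, inv_mul_cancel₀ ha, one_smul] at this

/-- functions whose slices over `R` lie in `V` and whose other slices vanish -/
def Fn {n : ℕ} (V : Submodule ℚ ((Fin n → ℕ × ℕ) → ℚ)) (R : Finset (ℕ × ℕ)) :
    Submodule ℚ ((Fin (n + 1) → ℕ × ℕ) → ℚ) where
  carrier := {u | ∀ z, (z ∈ R → (fun d => u (Fin.cons z d)) ∈ V) ∧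
    (z ∉ R → ∀ d : Fin n → ℕ × ℕ, u (Fin.cons z d) = 0)}
  zero_mem' z := ⟨fun _ => V.zero_mem, fun _ _ => rfl⟩
  add_mem' ha hb z := ⟨fun hz => V.add_mem ((ha z).1 hz) ((hb z).1 hz),
    fun hz d => by simp [(ha z).2 hz d, (hb z).2 hz d]⟩
  smul_mem' c a ha z := ⟨fun hz => V.smul_mem c ((ha z).1 hz),
    fun hz d => by simp [(ha z).2 hz d]⟩

theorem Fn_inf {n : ℕ} (V V' : Submodule ℚ ((Fin n → ℕ × ℕ) → ℚ)) (R R' : Finset (ℕ × ℕ)) :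
    Fn V R ⊓ Fn V' R' ≤ Fn (V ⊓ V') (R ∩ R') := by
  rintro u ⟨h1, h2⟩ z
  refine ⟨fun hz => ?_, fun hz d => ?_⟩
  · rw [Finset.mem_inter] at hz
    exact ⟨(h1 z).1 hz.1, (h2 z).1 hz.2⟩
  · rw [Finset.mem_inter, not_and_or] at hz
    rcases hz with hz | hz
    · exact (h1 z).2 hz d
    · exact (h2 z).2 hz d

/-- the slices -/
def FnEquiv {n : ℕ} (V : Submodule ℚ ((Fin n → ℕ × ℕ) → ℚ)) (R : Finset (ℕ × ℕ)) :
    Fn V R ≃ₗ[ℚ] (R → V) where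
  toFun u z := ⟨fun d => u.1 (Fin.cons z.1 d), (u.2 z.1).1 z.2⟩
  map_add' _ _ := rfl
  map_smul' _ _ := rfl
  invFun v := ⟨fun d => if h : d 0 ∈ R then (v ⟨d 0, h⟩).1 (Fin.tail d) else 0, fun z => by
    refine ⟨fun hz => ?_, fun hz d => ?_⟩
    · simp only [Fin.cons_zero, hz, dif_pos, Fin.tail_cons]
      exact (v ⟨z, hz⟩).2
    · simp [hz]⟩
  left_inv u := by
    ext d
    by_cases h : d 0 ∈ R
    · simp [h, Fin.cons_self_tail]
    · have := (u.2 (d 0)).2 h (Fin.tail d)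
      rw [Fin.cons_self_tail] at this
      simp [h, this]
  right_inv v := by
    ext z d
    simp

theorem Fn_finite {n : ℕ} (V : Submodule ℚ ((Fin n → ℕ × ℕ) → ℚ)) (R : Finset (ℕ × ℕ))
    [FiniteDimensional ℚ V] : FiniteDimensional ℚ (Fn V R) :=
  Module.Finite.equiv (FnEquiv V R).symm

theorem Fn_finrank {n : ℕ} (V : Submodule ℚ ((Fin n → ℕ × ℕ) → ℚ)) (R : Finset (ℕ × ℕ))
    [FiniteDimensional ℚ V] : Module.finrank ℚ (Fn V R) = R.card * Module.finrank ℚ V := by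
  rw [(FnEquiv V R).finrank_eq, Module.finrank_pi_fintype]
  simp

/-- `x^c G` -/
def liftG {n : ℕ} (c : ℕ × ℕ) (G : (Fin n → ℕ × ℕ) → ℚ) : (Fin (n + 1) → ℕ × ℕ) → ℚ :=
  fun d => if d 0 = c then G (Fin.tail d) else 0

/-- a single slice -/
def singleG {n : ℕ} (z : ℕ × ℕ) : ((Fin n → ℕ × ℕ) → ℚ) →ₗ[ℚ] ((Fin (n + 1) → ℕ × ℕ) → ℚ) where
  toFun := liftG z
  map_add' a b := by
    funext d; simp only [liftG, Pi.add_apply]; split_ifs <;> simp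
  map_smul' a b := by
    funext d; simp [liftG]

theorem SS_liftG {n : ℕ} (c : ℕ × ℕ) (G : (Fin n → ℕ × ℕ) → ℚ) :
    SS (liftG c G) = Fn (SS G) (Finset.Iic c) := by
  apply le_antisymm
  · refine Submodule.span_le.mpr ?_
    rintro _ ⟨d, rfl⟩ z
    refine ⟨fun _ => ?_, fun hz x => ?_⟩
    · by_cases h : d 0 + z = c
      · refine Submodule.subset_span ⟨Fin.tail d, ?_⟩
        funext x
        simp only [shiftF, liftG, Pi.add_apply, Fin.cons_zero, h, if_true]
        rfl
      · convert Submodule.zero_mem _ using 1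
        funext x
        simp [shiftF, liftG, h]
    · have h : d 0 + z ≠ c := by
        rintro rfl
        exact hz (by simp)
      simp [shiftF, liftG, h]
  · have hs : ∀ z ≤ c, ∀ v ∈ SS G, singleG z v ∈ SS (liftG c G) := by
      intro z hz
      have : SS G ≤ (SS (liftG c G)).comap (singleG z) := by
        refine Submodule.span_le.mpr ?_
        rintro _ ⟨d, rfl⟩
        refine Submodule.subset_span ⟨Fin.cons (c - z) d, ?_⟩
        funext x
        have hiff : c - z + x 0 = c ↔ x 0 = z := by
          have h1 := hz.1; have h2 := hz.2
          simp only [Prod.ext_iff, Prod.fst_add, Prod.snd_add, Prod.fst_sub, Prod.snd_sub]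
          omega
        simp only [shiftF, liftG, singleG, Pi.add_apply, Fin.cons_zero, LinearMap.coe_mk,
          AddHom.coe_mk, hiff]
        rfl
      exact this
    intro u hu
    have : u = ∑ z ∈ Finset.Iic c, singleG z (fun d => u (Fin.cons z d)) := by
      funext d
      rw [Finset.sum_apply]
      simp only [singleG, LinearMap.coe_mk, AddHom.coe_mk, liftG]
      rw [Finset.sum_ite_eq]
      split_ifs with h
      · rw [Fin.cons_self_tail]
      · have := (hu (d 0)).2 h (Fin.tail d)
        rwa [Fin.cons_self_tail] at this
    rw [this]
    refine Submodule.sum_mem _ fun z hz => hs z (by simpa using hz) _ ((hu z).1 hz)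

theorem gd_perm {n : ℕ} (e f : Fin n → ℕ × ℕ) (he : Function.Injective e)
    (hf : Function.Injective f) (h : Set.range e = Set.range f) :
    ∃ ε : ℚ, ε ≠ 0 ∧ gd e = ε • gd f := by
  let σ : Equiv.Perm (Fin n) := (Equiv.ofInjective e he).trans
    ((Equiv.setCongr h).trans (Equiv.ofInjective f hf).symm)
  have hσ : ∀ i, f (σ i) = e i := by
    intro i
    have := congrArg Subtype.val ((Equiv.ofInjective f hf).apply_symm_apply
      ((Equiv.setCongr h) (Equiv.ofInjective e he i)))
    exact this
  refine ⟨((Equiv.Perm.sign σ : ℤ) : ℚ), ?_, ?_⟩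
  · simp
  · funext d
    simp only [Pi.smul_apply, smul_eq_mul, gd]
    rw [← Matrix.det_permute']
    congr 1
    ext r c
    simp [hσ]

theorem gd_succ {n : ℕ} (e : Fin (n + 1) → ℕ × ℕ) (he : Function.Injective e) (j : Fin (n + 1))
    (d : Fin (n + 1) → ℕ × ℕ) (hj : d 0 = e j) :
    gd e d = (-1) ^ (j : ℕ) * gd (e ∘ j.succAbove) (Fin.tail d) := by
  unfold gd
  rw [Matrix.det_succ_row_zero, Finset.sum_eq_single j]
  · simp only [Matrix.of_apply, hj, if_true, mul_one]
    rfl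
  · intro b _ hb
    have : e b ≠ d 0 := by rw [hj]; exact fun h => hb (he h)
    simp [this]
  · simp

theorem gd_succ_zero {n : ℕ} (e : Fin (n + 1) → ℕ × ℕ)
    (d : Fin (n + 1) → ℕ × ℕ) (hj : ∀ j, d 0 ≠ e j) : gd e d = 0 := by
  refine gd_eq_zero e d ?_
  rintro ⟨σ, hσ⟩
  exact hj (σ.symm 0) (by rw [hσ]; simp)

theorem gd_corner {n : ℕ} (e : Fin (n + 1) → ℕ × ℕ) (he : Function.Injective e) (c : ℕ × ℕ)
    (e₁ : Fin n → ℕ × ℕ) (he₁ : Function.Injective e₁) (hc : c ∈ Set.range e)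
    (h : Set.range e₁ = Set.range e \ {c}) :
    ∃ ε : ℚ, ε ≠ 0 ∧ ∀ d, d 0 = c → gd e d = liftG c (ε • gd e₁) d := by
  obtain ⟨j, rfl⟩ := hc
  obtain ⟨ε, h0, hε⟩ := gd_perm (e ∘ j.succAbove) e₁
    (he.comp Fin.succAbove_right_injective) he₁ (by
      rw [h, Set.range_comp, Fin.range_succAbove, Set.compl_eq_univ_sdiff,
        Set.image_sdiff he, Set.image_univ, Set.image_singleton])
  refine ⟨(-1) ^ (j : ℕ) * ε, mul_ne_zero (by simp) h0, fun d hd => ?_⟩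
  rw [gd_succ e he j d hd, hε]
  simp [liftG, hd, mul_assoc]

/-- weight of the last pair of exponents -/
def wtZero {n : ℕ} (α β : ℤ) : (Fin (n + 1) → ℕ × ℕ) →+ ℤ where
  toFun d := -(α * (d 0).1 + β * (d 0).2)
  map_zero' := by simp
  map_add' a b := by simp; ring

theorem lower {n : ℕ} (e : Fin (n + 1) → ℕ × ℕ) (he : Function.Injective e)
    (hfin : FiniteDimensional ℚ (SS (gd e)))
    (c₁ c₂ : ℕ × ℕ) (hne : c₁ ≠ c₂) (hc₁ : c₁ ∈ Set.range e) (hc₂ : c₂ ∈ Set.range e)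
    (e₁ e₂ : Fin n → ℕ × ℕ) (he₁ : Function.Injective e₁) (he₂ : Function.Injective e₂)
    (hr₁ : Set.range e₁ = Set.range e \ {c₁}) (hr₂ : Set.range e₂ = Set.range e \ {c₂})
    (α β : ℤ) (hα : 0 < α) (hβ : 0 < β)
    (hw : α * c₁.1 + β * c₁.2 = α * c₂.1 + β * c₂.2)
    (hcov : ∀ z, z ∈ Set.range e ↔ z ≤ c₁ ∨ z ≤ c₂)
    (N : ℕ) (hN : 0 < 2 * N)
    (h₁ : Module.finrank ℚ (SS (gd e₁)) = 2 * N) (h₂ : Module.finrank ℚ (SS (gd e₂)) = 2 * N)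
    (h₁₂ : Module.finrank ℚ (SS (gd e₁) ⊓ SS (gd e₂) : Submodule ℚ _) = N) :
    (n + 1) * (2 * N) ≤ Module.finrank ℚ (SS (gd e)) := by
  have f₁ : FiniteDimensional ℚ (SS (gd e₁)) := Module.finite_of_finrank_pos (by omega)
  have f₂ : FiniteDimensional ℚ (SS (gd e₂)) := Module.finite_of_finrank_pos (by omega)
  obtain ⟨ε₁, hε₁, hg₁⟩ := gd_corner e he c₁ e₁ he₁ hc₁ hr₁
  obtain ⟨ε₂, hε₂, hg₂⟩ := gd_corner e he c₂ e₂ he₂ hc₂ hr₂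
  set g₁ := liftG c₁ (ε₁ • gd e₁) with hg₁def
  set g₂ := liftG c₂ (ε₂ • gd e₂) with hg₂def
  have hS₁ : SS g₁ = Fn (SS (gd e₁)) (Finset.Iic c₁) := by
    rw [hg₁def, SS_liftG, SS_smul _ hε₁]
  have hS₂ : SS g₂ = Fn (SS (gd e₂)) (Finset.Iic c₂) := by
    rw [hg₂def, SS_liftG, SS_smul _ hε₂]
  have ff₁ : FiniteDimensional ℚ (SS g₁) := by rw [hS₁]; exact Fn_finite _ _
  have ff₂ : FiniteDimensional ℚ (SS g₂) := by rw [hS₂]; exact Fn_finite _ _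
  have hk := finrank_SS_add g₁ g₂
  have hd₁ : Module.finrank ℚ (SS g₁) = (Finset.Iic c₁).card * (2 * N) := by
    rw [hS₁, Fn_finrank, h₁]
  have hd₂ : Module.finrank ℚ (SS g₂) = (Finset.Iic c₂).card * (2 * N) := by
    rw [hS₂, Fn_finrank, h₂]
  have hd₃ : Module.finrank ℚ (SS g₁ ⊓ SS g₂ : Submodule ℚ _) ≤
      (Finset.Iic c₁ ∩ Finset.Iic c₂).card * N := by
    rw [← h₁₂, ← Fn_finrank, hS₁, hS₂]
    have := Fn_finite (SS (gd e₁) ⊓ SS (gd e₂)) (Finset.Iic c₁ ∩ Finset.Iic c₂)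
    exact Submodule.finrank_mono (Fn_inf _ _ _ _)
  -- weights
  have hlt : ∀ z c : ℕ × ℕ, z ≤ c → z ≠ c → α * z.1 + β * z.2 < α * c.1 + β * c.2 := by
    intro z c hz hzc
    have h1 : (z.1 : ℤ) ≤ c.1 := by exact_mod_cast hz.1
    have h2 : (z.2 : ℤ) ≤ c.2 := by exact_mod_cast hz.2
    have h3 : (z.1 : ℤ) < c.1 ∨ (z.2 : ℤ) < c.2 := by
      by_contra h
      push Not at h
      apply hzc
      ext <;> omega
    rcases h3 with h3 | h3 <;> nlinarith
  have hdeg := finrank_degen (wtZero α β) (-(α * c₁.1 + β * c₁.2)) (g₁ + g₂) (gd e) ?_ ?_ ?_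
  · have hcard : (Finset.Iic c₁ ∪ Finset.Iic c₂).card = n + 1 := by
      have : Finset.Iic c₁ ∪ Finset.Iic c₂ = Finset.univ.image e := by
        ext z
        have := hcov z
        simp only [Set.mem_range] at this
        simp [this]
      rw [this, Finset.card_image_of_injective _ he]; simp
    have hui := Finset.card_union_add_card_inter (Finset.Iic c₁) (Finset.Iic c₂)
    rw [hcard] at hui
    have hle := hdeg.2
    have : (n + 1) * (2 * N) + (Finset.Iic c₁ ∩ Finset.Iic c₂).card * (2 * N) =
      (Finset.Iic c₁).card * (2 * N) + (Finset.Iic c₂).card * (2 * N) := by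
      rw [← add_mul, hui, add_mul]
    nlinarith
  · intro d hd
    change -(α * ((d 0).1 : ℤ) + β * ((d 0).2 : ℤ)) < _ at hd
    apply gd_succ_zero
    intro j hj
    have hz := (hcov (d 0)).mp ⟨j, hj.symm⟩
    rcases hz with hz | hz
    · by_cases h : d 0 = c₁
      · rw [h] at hd; omega
      · have := hlt _ _ hz h; omega
    · by_cases h : d 0 = c₂
      · rw [h] at hd; omega
      · have := hlt _ _ hz h; omega
  · intro d hd
    change -(α * ((d 0).1 : ℤ) + β * ((d 0).2 : ℤ)) = _ at hd
    rw [Pi.add_apply]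
    by_cases hd1 : d 0 = c₁
    · rw [hg₁ d hd1]
      have : d 0 ≠ c₂ := by rw [hd1]; exact hne
      simp [g₂, liftG, this]
    · by_cases hd2 : d 0 = c₂
      · rw [hg₂ d hd2]
        simp [g₁, liftG, hd1]
      · rw [gd_succ_zero e d ?_]
        · simp [g₁, g₂, liftG, hd1, hd2]
        · intro j hj
          have hz := (hcov (d 0)).mp ⟨j, hj.symm⟩
          rcases hz with hz | hz
          · have := hlt _ _ hz hd1; omega
          · have := hlt _ _ hz hd2; omega
  · intro d hd
    change -(α * ((d 0).1 : ℤ) + β * ((d 0).2 : ℤ)) ≠ _ at hd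
    have hd1 : d 0 ≠ c₁ := by rintro h; rw [h] at hd; omega
    have hd2 : d 0 ≠ c₂ := by rintro h; rw [h] at hd; omega
    simp [g₁, g₂, liftG, hd1, hd2]

end Lower

section Transfer

variable {n : ℕ}

/-- product of factorials -/
def fac (m : (Fin n ⊕ Fin n) →₀ ℕ) : ℚ := ∏ v, ((m v).factorial : ℚ)

theorem fac_pos (m : (Fin n ⊕ Fin n) →₀ ℕ) : 0 < fac m :=
  Finset.prod_pos fun _ _ => by exact_mod_cast Nat.factorial_pos _

theorem fac_add_single (m : (Fin n ⊕ Fin n) →₀ ℕ) (v : Fin n ⊕ Fin n) :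
    fac (m + Finsupp.single v 1) = fac m * (m v + 1) := by
  unfold fac
  rw [← Finset.mul_prod_erase _ _ (Finset.mem_univ v),
    ← Finset.mul_prod_erase _ (fun w => ((m w).factorial : ℚ)) (Finset.mem_univ v)]
  have : ∏ x ∈ Finset.univ.erase v, (((m + Finsupp.single v 1 : (Fin n ⊕ Fin n) →₀ ℕ) x).factorial : ℚ) =
      ∏ x ∈ Finset.univ.erase v, ((m x).factorial : ℚ) := by
    refine Finset.prod_congr rfl fun w hw => ?_
    have : v ≠ w := (Finset.ne_of_mem_erase hw).symm
    simp [Finsupp.single_apply, this]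
  rw [this]
  simp [Nat.factorial_succ]
  ring

/-- normalised coefficient -/
noncomputable def nc (F : MvPolynomial (Fin n ⊕ Fin n) ℚ) (m : (Fin n ⊕ Fin n) →₀ ℕ) : ℚ :=
  fac m * coeff m F

theorem nc_pderiv (F : MvPolynomial (Fin n ⊕ Fin n) ℚ) (v : Fin n ⊕ Fin n)
    (m : (Fin n ⊕ Fin n) →₀ ℕ) : nc (pderiv v F) m = nc F (m + Finsupp.single v 1) := by
  unfold nc
  rw [fac_add_single, coeff_pderiv]
  ring

theorem nc_pderiv_pow (k : ℕ) (F : MvPolynomial (Fin n ⊕ Fin n) ℚ) (v : Fin n ⊕ Fin n)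
    (m : (Fin n ⊕ Fin n) →₀ ℕ) :
    nc ((((pderiv v).toLinearMap : Module.End ℚ (MvPolynomial (Fin n ⊕ Fin n) ℚ)) ^ k) F) m =
      nc F (m + Finsupp.single v k) := by
  induction k generalizing m with
  | zero => simp
  | succ k ih =>
    rw [pow_succ', Module.End.mul_apply]
    refine (nc_pderiv _ v m).trans ?_
    rw [ih, add_assoc, ← Finsupp.single_add, add_comm 1 k]

theorem nc_list (l : List (Fin n ⊕ Fin n)) (d : (Fin n ⊕ Fin n) →₀ ℕ)
    (F : MvPolynomial (Fin n ⊕ Fin n) ℚ) (m : (Fin n ⊕ Fin n) →₀ ℕ) :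
    nc ((l.map fun v => ((pderiv v).toLinearMap :
      Module.End ℚ (MvPolynomial (Fin n ⊕ Fin n) ℚ)) ^ d v).prod F) m =
      nc F (m + (l.map fun v => Finsupp.single v (d v)).sum) := by
  induction l generalizing m with
  | nil => simp
  | cons v l ih =>
    rw [List.map_cons, List.prod_cons, Module.End.mul_apply, nc_pderiv_pow, ih, List.map_cons,
      List.sum_cons, add_assoc]

theorem nc_derivMonomial (d : (Fin n ⊕ Fin n) →₀ ℕ)
    (F : MvPolynomial (Fin n ⊕ Fin n) ℚ) (m : (Fin n ⊕ Fin n) →₀ ℕ) :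
    nc (derivMonomial n d F) m = nc F (m + d) := by
  unfold derivMonomial
  rw [nc_list, Finset.sum_map_toList]
  congr 2
  exact Finsupp.sum_single d

theorem apolar_eq (P Q : MvPolynomial (Fin n ⊕ Fin n) ℚ) :
    apolar n P Q = ∑ d ∈ P.support, coeff d P * (fac d * coeff d Q) := by
  unfold apolar applyDiff
  rw [map_sum]
  refine Finset.sum_congr rfl fun d _ => ?_
  have h := nc_derivMonomial d Q 0
  rw [zero_add] at h
  have h0 : fac (0 : (Fin n ⊕ Fin n) →₀ ℕ) = 1 := by simp [fac]
  unfold nc at h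
  rw [h0, one_mul] at h
  rw [← h, constantCoeff_eq, coeff_smul, smul_eq_mul]

/-- the apolar form -/
noncomputable def apB (n : ℕ) : MvPolynomial (Fin n ⊕ Fin n) ℚ →ₗ[ℚ]
    (MvPolynomial (Fin n ⊕ Fin n) ℚ →ₗ[ℚ] ℚ) :=
  (basisMonomials (Fin n ⊕ Fin n) ℚ).constr ℚ (fun m => fac m • lcoeff ℚ m)

theorem apB_eq (P Q : MvPolynomial (Fin n ⊕ Fin n) ℚ) : apB n P Q = apolar n P Q := by
  rw [apolar_eq, apB, Module.Basis.constr_apply]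
  simp only [Finsupp.sum, LinearMap.sum_apply, LinearMap.smul_apply, smul_eq_mul]
  rfl

theorem apolar_self {P : MvPolynomial (Fin n ⊕ Fin n) ℚ} (h : apolar n P P = 0) : P = 0 := by
  rw [apolar_eq, Finset.sum_eq_zero_iff_of_nonneg] at h
  · by_contra hP
    obtain ⟨d, hd⟩ := (support_nonempty (p := P)).mpr hP
    have h1 := h d hd
    have h2 := mem_support_iff.mp hd
    have h3 := (fac_pos d).ne'
    simp_all
  · intro d _
    have := fac_pos d
    nlinarith [mul_nonneg this.le (mul_self_nonneg (coeff d P))]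

theorem finrank_orth (V N : Submodule ℚ (MvPolynomial (Fin n ⊕ Fin n) ℚ)) (hN : N ≤ V)
    [FiniteDimensional ℚ V] :
    Set.finrank ℚ {P | P ∈ V ∧ ∀ Q ∈ N, apolar n P Q = 0} + Module.finrank ℚ N =
      Module.finrank ℚ V := by
  have hfN : FiniteDimensional ℚ N := Submodule.finiteDimensional_of_le hN
  let T : V →ₗ[ℚ] Module.Dual ℚ N := (LinearMap.lcomp ℚ ℚ N.subtype).comp ((apB n).comp V.subtype)
  have hT : ∀ (P : V) (Q : N), T P Q = apolar n P.1 Q.1 := fun P Q => apB_eq _ _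
  have hset : {P | P ∈ V ∧ ∀ Q ∈ N, apolar n P Q = 0} =
      ((LinearMap.ker T).map V.subtype : Set (MvPolynomial (Fin n ⊕ Fin n) ℚ)) := by
    ext P
    simp only [Set.mem_ofPred_eq, SetLike.mem_coe, Submodule.mem_map, LinearMap.mem_ker]
    constructor
    · rintro ⟨hP, h⟩
      refine ⟨⟨P, hP⟩, ?_, rfl⟩
      ext Q
      rw [hT]
      exact h _ Q.2
    · rintro ⟨P, h, rfl⟩
      refine ⟨P.2, fun Q hQ => ?_⟩
      have := hT P ⟨Q, hQ⟩
      rw [h] at this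
      exact this.symm
  have hk : Set.finrank ℚ {P | P ∈ V ∧ ∀ Q ∈ N, apolar n P Q = 0} =
      Module.finrank ℚ (LinearMap.ker T) := by
    rw [hset, Set.finrank, Submodule.span_eq]
    exact (Submodule.equivMapOfInjective _ V.injective_subtype _).finrank_eq.symm
  have hinj : Function.Injective (T.comp (Submodule.inclusion hN)) := by
    rw [injective_iff_map_eq_zero]
    intro P hP
    have := hT (Submodule.inclusion hN P) P
    rw [LinearMap.comp_apply] at hP
    rw [hP] at this
    exact Subtype.ext (apolar_self this.symm)
  have h1 := LinearMap.finrank_range_of_inj hinj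
  have h2 : LinearMap.range (T.comp (Submodule.inclusion hN)) ≤ LinearMap.range T :=
    LinearMap.range_comp_le_range _ _
  have h3 := Submodule.finrank_mono h2
  have h4 := Submodule.finrank_le (LinearMap.range T)
  rw [Subspace.dual_finrank_eq] at h4
  have h5 := LinearMap.finrank_range_add_finrank_ker T
  omega

/-- exponent vectors as finitely supported functions -/
noncomputable def toF (d : Fin n → ℕ × ℕ) : (Fin n ⊕ Fin n) →₀ ℕ :=
  Finsupp.equivFunOnFinite.symm (Sum.elim (fun r => (d r).1) (fun r => (d r).2))

theorem toF_inl (d : Fin n → ℕ × ℕ) (r : Fin n) : toF d (Sum.inl r) = (d r).1 := rfl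
theorem toF_inr (d : Fin n → ℕ × ℕ) (r : Fin n) : toF d (Sum.inr r) = (d r).2 := rfl

theorem toF_surj (m : (Fin n ⊕ Fin n) →₀ ℕ) : ∃ d, toF d = m := by
  refine ⟨fun r => (m (Sum.inl r), m (Sum.inr r)), ?_⟩
  ext v
  rcases v with v | v <;> rfl

theorem toF_inj : Function.Injective (toF (n := n)) := by
  intro a b h
  funext r
  exact Prod.ext (DFunLike.congr_fun h (Sum.inl r)) (DFunLike.congr_fun h (Sum.inr r))

/-- unit exponent vectors -/
def unitV (v : Fin n ⊕ Fin n) : Fin n → ℕ × ℕ :=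
  Sum.elim (fun r => Pi.single r (1, 0)) (fun r => Pi.single r (0, 1)) v

theorem toF_unit (v : Fin n ⊕ Fin n) (d : Fin n → ℕ × ℕ) :
    toF (unitV v + d) = toF d + Finsupp.single v 1 := by
  ext w
  rcases v with v | v <;> rcases w with w | w <;>
    by_cases h : v = w <;>
    simp [toF_inl, toF_inr, unitV, Finsupp.single_apply, Pi.single_apply, h, add_comm, eq_comm]

/-- normalised coefficients -/
noncomputable def phi : MvPolynomial (Fin n ⊕ Fin n) ℚ →ₗ[ℚ] ((Fin n → ℕ × ℕ) → ℚ) where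
  toFun F d := nc F (toF d)
  map_add' a b := by funext d; simp [nc, mul_add]
  map_smul' a b := by funext d; simp [nc]; ring

theorem phi_inj : Function.Injective (phi (n := n)) := by
  rw [injective_iff_map_eq_zero]
  intro F hF
  ext m
  obtain ⟨d, rfl⟩ := toF_surj m
  have : fac (toF d) * coeff (toF d) F = 0 := congrFun hF d
  rw [coeff_zero]
  exact (mul_eq_zero.mp this).resolve_left (fac_pos _).ne'

theorem phi_foldr (L : List (Fin n ⊕ Fin n)) (F : MvPolynomial (Fin n ⊕ Fin n) ℚ) :
    phi (L.foldr (fun v Q => pderiv v Q) F) = shiftF (phi F) (L.map unitV).sum := by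
  induction L with
  | nil => funext d; simp [shiftF]
  | cons v L ih =>
    funext d
    have h := nc_pderiv (L.foldr (fun v Q => pderiv v Q) F) v (toF d)
    rw [← toF_unit] at h
    refine h.trans ?_
    have h2 := congrFun ih (unitV v + d)
    refine h2.trans ?_
    simp only [shiftF, List.map_cons, List.sum_cons]
    exact congrArg (phi F) (by rw [← add_assoc, add_comm (List.sum _) (unitV v)])

theorem unit_list (d : Fin n → ℕ × ℕ) : ∃ L : List (Fin n ⊕ Fin n), (L.map unitV).sum = d := by
  have hd : d ∈ AddSubmonoid.closure (Set.range (unitV (n := n))) := by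
    have : d = ∑ r, ((d r).1 • unitV (Sum.inl r) + (d r).2 • unitV (Sum.inr r)) := by
      funext s
      rw [Finset.sum_apply, Finset.sum_eq_single s]
      · ext <;> simp [unitV]
      · intro b _ hb
        simp [unitV, Pi.single_apply, hb.symm]
      · simp
    rw [this]
    have hu : ∀ v, unitV v ∈ AddSubmonoid.closure (Set.range (unitV (n := n))) :=
      fun v => AddSubmonoid.subset_closure ⟨v, rfl⟩
    exact AddSubmonoid.sum_mem _ fun r _ => AddSubmonoid.add_mem _
      (AddSubmonoid.nsmul_mem _ (hu _) _) (AddSubmonoid.nsmul_mem _ (hu _) _)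
  obtain ⟨l, hl, rfl⟩ := AddSubmonoid.exists_list_of_mem_closure hd
  have : l ∈ Set.range (List.map (unitV (n := n))) := by
    rw [Set.range_list_map]
    exact hl
  obtain ⟨L, rfl⟩ := this
  exact ⟨L, rfl⟩

theorem map_derivSpan (F : MvPolynomial (Fin n ⊕ Fin n) ℚ) :
    (derivSpan n F).map phi = SS (phi F) := by
  unfold derivSpan SS
  rw [Submodule.map_span]
  congr 1
  ext u
  constructor
  · rintro ⟨_, ⟨L, rfl⟩, rfl⟩
    exact ⟨_, (phi_foldr L F).symm⟩
  · rintro ⟨d, rfl⟩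
    obtain ⟨L, rfl⟩ := unit_list d
    exact ⟨_, ⟨L, rfl⟩, phi_foldr L F⟩

theorem coeff_Delta (cells : Finset (ℕ × ℕ)) (e : Fin n ≃ {c // c ∈ cells})
    (d : Fin n → ℕ × ℕ) : coeff (toF d) (Delta n cells e) = gd (fun i => (e i).1) d := by
  unfold Delta gd
  rw [Matrix.det_apply', Matrix.det_apply', coeff_sum]
  refine Finset.sum_congr rfl fun σ _ => ?_
  have h1 : ∏ i, (Matrix.of fun r c : Fin n => (X (Sum.inl r) ^ ((e c).val.1) *
      X (Sum.inr r) ^ ((e c).val.2) : MvPolynomial (Fin n ⊕ Fin n) ℚ)) (σ i) i =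
      monomial (toF (fun r => (e (σ.symm r)).1)) 1 := by
    rw [monomial_eq, Finsupp.prod_fintype _ _ (by simp), Fintype.prod_sum_type,
      ← Finset.prod_mul_distrib, map_one, one_mul,
      ← Equiv.prod_comp σ (fun r => X (Sum.inl r) ^ _ * X (Sum.inr r) ^ _)]
    refine Finset.prod_congr rfl fun i _ => ?_
    simp [toF_inl, toF_inr]
  rw [h1]
  have h2 : (((Equiv.Perm.sign σ : ℤ) : MvPolynomial (Fin n ⊕ Fin n) ℚ)) =
      C ((Equiv.Perm.sign σ : ℤ) : ℚ) := by simp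
  rw [h2, coeff_C_mul, coeff_monomial]
  congr 1
  simp only [Matrix.of_apply]
  by_cases h : (fun r => (e (σ.symm r)).1) = d
  · subst h; simp
  · rw [if_neg fun h' => h (toF_inj h')]
    have : ∃ i, (e i).1 ≠ d (σ i) := by
      by_contra hc
      push Not at hc
      exact h (by funext r; rw [hc]; simp)
    obtain ⟨i, hi⟩ := this
    exact (Finset.prod_eq_zero (Finset.mem_univ i) (by simp [hi])).symm

theorem fac_toF (d : Fin n → ℕ × ℕ) :
    fac (toF d) = ∏ r, (((d r).1.factorial : ℚ) * ((d r).2.factorial : ℚ)) := by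
  unfold fac
  rw [Fintype.prod_sum_type, ← Finset.prod_mul_distrib]
  rfl

theorem phi_Delta (cells : Finset (ℕ × ℕ)) (e : Fin n ≃ {c // c ∈ cells}) :
    phi (Delta n cells e) = fac (toF fun i => (e i).1) • gd (fun i => (e i).1) := by
  funext d
  change fac (toF d) * coeff (toF d) (Delta n cells e) = _
  rw [coeff_Delta, Pi.smul_apply, smul_eq_mul]
  by_cases h : ∃ σ : Equiv.Perm (Fin n), ∀ i, (e i).1 = d (σ i)
  · obtain ⟨σ, hσ⟩ := h
    congr 1
    rw [fac_toF, fac_toF, ← Equiv.prod_comp σ]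
    simp only [hσ]
  · rw [gd_eq_zero _ _ h, mul_zero, mul_zero]

theorem map_GH (cells : Finset (ℕ × ℕ)) (e : Fin n ≃ {c // c ∈ cells}) :
    (GHmodule n cells e).map phi = SS (gd (fun i => (e i).1)) := by
  unfold GHmodule
  rw [map_derivSpan, phi_Delta, SS_smul _ (fac_pos _).ne']

end Transfer

/-- Garsia–Bergeron Proposition 1.1, second part: if `μ ⊢ n+1` has exactly two
corner cells, the `n!`-conjecture holds for both predecessors `α⁽¹⁾, α⁽²⁾`, and
`dim (M_{α⁽¹⁾} ∩ M_{α⁽²⁾}) = n!/2`, then the orthogonal complement (for the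
apolar scalar product) of `M_{α⁽¹⁾} ∩ M_{α⁽²⁾}` inside `M_{α⁽ⁱ⁾}` has dimension
`n!/2` for `i = 1, 2`, and `dim M_μ = (n+1)!`. -/
theorem statement3 (n : ℕ) (cells : Finset (ℕ × ℕ))
    (hcard : cells.card = n + 1) (hdiag : IsLowerDiagram cells)
    (c₁ c₂ : ℕ × ℕ) (hne : c₁ ≠ c₂)
    (hc₁ : IsCornerCell cells c₁) (hc₂ : IsCornerCell cells c₂)
    (honly : ∀ c, IsCornerCell cells c → c = c₁ ∨ c = c₂)
    (eμ : Fin (n + 1) ≃ {c // c ∈ cells})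
    (e₁ : Fin n ≃ {c // c ∈ cells.erase c₁})
    (e₂ : Fin n ≃ {c // c ∈ cells.erase c₂})
    (h₁ : Module.finrank ℚ ↥(GHmodule n (cells.erase c₁) e₁) = Nat.factorial n)
    (h₂ : Module.finrank ℚ ↥(GHmodule n (cells.erase c₂) e₂) = Nat.factorial n)
    (hmeet : Module.finrank ℚ
        ↥(GHmodule n (cells.erase c₁) e₁ ⊓ GHmodule n (cells.erase c₂) e₂) =
      Nat.factorial n / 2) :
    Set.finrank ℚ {P | P ∈ GHmodule n (cells.erase c₁) e₁ ∧
        ∀ Q ∈ GHmodule n (cells.erase c₁) e₁ ⊓ GHmodule n (cells.erase c₂) e₂,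
          apolar n P Q = 0} = Nat.factorial n / 2 ∧
    Set.finrank ℚ {P | P ∈ GHmodule n (cells.erase c₂) e₂ ∧
        ∀ Q ∈ GHmodule n (cells.erase c₁) e₁ ⊓ GHmodule n (cells.erase c₂) e₂,
          apolar n P Q = 0} = Nat.factorial n / 2 ∧
    Module.finrank ℚ ↥(GHmodule (n + 1) cells eμ) = Nat.factorial (n + 1) := by
  have hm₁ := map_GH _ e₁
  have hm₂ := map_GH _ e₂
  have hmμ := map_GH _ eμ
  have hfr : ∀ {k : ℕ} (V : Submodule ℚ (MvPolynomial (Fin k ⊕ Fin k) ℚ)),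
      Module.finrank ℚ (V.map phi) = Module.finrank ℚ V := fun V =>
    (Submodule.equivMapOfInjective _ phi_inj V).finrank_eq.symm
  have hinj : ∀ {k : ℕ} {s : Finset (ℕ × ℕ)} (e : Fin k ≃ {c // c ∈ s}),
      Function.Injective (fun i => (e i).1) := fun e =>
    Subtype.val_injective.comp e.injective
  have hrange : ∀ {k : ℕ} {s : Finset (ℕ × ℕ)} (e : Fin k ≃ {c // c ∈ s}),
      Set.range (fun i => (e i).1) = (s : Set (ℕ × ℕ)) := by
    intro k s e
    ext z
    constructor
    · rintro ⟨i, rfl⟩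
      exact (e i).2
    · intro hz
      exact ⟨e.symm ⟨z, hz⟩, by simp⟩
  -- incomparability of the corners
  have h12 : ¬ c₁ ≤ c₂ := fun h =>
    (Finset.notMem_erase c₁ cells)
      (hc₁.2 c₂ (Finset.mem_erase.mpr ⟨hne.symm, hc₂.1⟩) c₁ h.1 h.2)
  have h21 : ¬ c₂ ≤ c₁ := fun h =>
    (Finset.notMem_erase c₂ cells)
      (hc₂.2 c₁ (Finset.mem_erase.mpr ⟨hne, hc₁.1⟩) c₂ h.1 h.2)
  have hn2 : 2 ≤ n := by
    have h0 : (0 : ℕ × ℕ) ∈ cells := hdiag c₁ hc₁.1 0 (Nat.zero_le _) (Nat.zero_le _)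
    have hsub : ({0, c₁, c₂} : Finset (ℕ × ℕ)) ⊆ cells := by
      intro z hz
      simp only [Finset.mem_insert, Finset.mem_singleton] at hz
      rcases hz with rfl | rfl | rfl
      exacts [h0, hc₁.1, hc₂.1]
    have h01 : (0 : ℕ × ℕ) ≠ c₁ := by
      rintro rfl
      exact h12 ⟨Nat.zero_le _, Nat.zero_le _⟩
    have h02 : (0 : ℕ × ℕ) ≠ c₂ := by
      rintro rfl
      exact h21 ⟨Nat.zero_le _, Nat.zero_le _⟩
    have := Finset.card_le_card hsub
    rw [Finset.card_eq_three.mpr ⟨0, c₁, c₂, h01, h02, hne, rfl⟩] at this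
    omega
  obtain ⟨N, hN⟩ : 2 ∣ n.factorial := Nat.dvd_factorial (by omega) hn2
  have hpos := Nat.factorial_pos n
  have hhalf : n.factorial / 2 = N := by omega
  rw [hhalf] at hmeet ⊢
  have f₁ : FiniteDimensional ℚ (GHmodule n (cells.erase c₁) e₁) :=
    Module.finite_of_finrank_pos (by omega)
  have f₂ : FiniteDimensional ℚ (GHmodule n (cells.erase c₂) e₂) :=
    Module.finite_of_finrank_pos (by omega)
  refine ⟨?_, ?_, ?_⟩
  · have := finrank_orth (GHmodule n (cells.erase c₁) e₁) _ (inf_le_left :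
      GHmodule n (cells.erase c₁) e₁ ⊓ GHmodule n (cells.erase c₂) e₂ ≤ _)
    omega
  · have := finrank_orth (GHmodule n (cells.erase c₂) e₂) _ (inf_le_right :
      GHmodule n (cells.erase c₁) e₁ ⊓ GHmodule n (cells.erase c₂) e₂ ≤ _)
    omega
  · rw [← hfr, hmμ]
    have hup := upper (fun i => (eμ i).1) (hinj eμ) (by
      rw [hrange]
      intro a b hba ha
      exact hdiag a ha b hba.1 hba.2)
    refine le_antisymm hup.2 ?_
    obtain ⟨α, β, hα, hβ, hw⟩ : ∃ α β : ℤ, 0 < α ∧ 0 < β ∧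
        α * c₁.1 + β * c₁.2 = α * c₂.1 + β * c₂.2 := by
      rw [Prod.le_def, not_and_or, not_le, not_le] at h12 h21
      rcases lt_or_ge c₁.1 c₂.1 with h | h
      · exact ⟨(c₁.2 : ℤ) - c₂.2, (c₂.1 : ℤ) - c₁.1, by omega, by omega, by ring⟩
      · exact ⟨(c₂.2 : ℤ) - c₁.2, (c₁.1 : ℤ) - c₂.1, by omega, by omega, by ring⟩
    have hlow := lower (fun i => (eμ i).1) (hinj eμ) hup.1 c₁ c₂ hne
      (by rw [hrange]; exact hc₁.1) (by rw [hrange]; exact hc₂.1)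
      (fun i => (e₁ i).1) (fun i => (e₂ i).1) (hinj e₁) (hinj e₂)
      (by rw [hrange, hrange, Finset.coe_erase]) (by rw [hrange, hrange, Finset.coe_erase])
      α β hα hβ hw ?_ N (by omega)
      (by rw [← hm₁, hfr, h₁, hN]) (by rw [← hm₂, hfr, h₂, hN])
      (by rw [← hm₁, ← hm₂, ← Submodule.map_inf _ phi_inj, hfr, hmeet])
    · rw [Nat.factorial_succ, hN]
      exact hlow
    · intro z
      rw [hrange]
      constructor
      · intro hz
        obtain ⟨c, hzc, hc⟩ := cells.exists_le_maximal hz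
        have hcorner : IsCornerCell cells c := by
          refine ⟨hc.1, ?_⟩
          intro x hx y hy1 hy2
          rw [Finset.mem_erase] at hx ⊢
          refine ⟨?_, hdiag x hx.2 y hy1 hy2⟩
          rintro rfl
          exact hx.1 (le_antisymm (hc.2 hx.2 ⟨hy1, hy2⟩) ⟨hy1, hy2⟩)
        rcases honly c hcorner with rfl | rfl
        · exact Or.inl hzc
        · exact Or.inr hzc
      · rintro (h | h)
        · exact hdiag c₁ hc₁.1 z h.1 h.2
        · exact hdiag c₂ hc₂.1 z h.1 h.2
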